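/- Let c ∈ ℂ and let ψ : ℝ³ \ {0} → ℂ, ψ(x) = e^{ic|x|}/(4π|x|), regarded as a scalar (zero vector part) ℍ(ℂ)-valued function. Then for every x ≠ 0, Dψ(x) = (-x/|x|² + ic·x/|x|)·ψ(x), where x on the right-hand side denotes the pure quaternion Σ_{k=1}^3 xₖ i_k (with the real coordinates xₖ viewed as complex scalars). -/

import Mathlib

noncomputable section

/-- Partial derivative `∂ₖ` of a complex-valued function on Euclidean `ℝ³`. -/
def pd (k : Fin 3) (g : EuclideanSpace ℝ (Fin 3) → ℂ) (x : EuclideanSpace ℝ (Fin 3)) : ℂ :=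
  fderiv ℝ g x (EuclideanSpace.single k 1)

/-- Embedding of a vector in `ℂ³` as a pure (vector-part) complex quaternion
`v₁i₁ + v₂i₂ + v₃i₃`. -/
def vecQ (v : Fin 3 → ℂ) : Quaternion ℂ := ⟨0, v 0, v 1, v 2⟩

/-- Componentwise partial derivative of an `ℍ(ℂ)`-valued function. -/
def pdQ (k : Fin 3) (f : EuclideanSpace ℝ (Fin 3) → Quaternion ℂ)
    (x : EuclideanSpace ℝ (Fin 3)) : Quaternion ℂ :=
  ⟨pd k (fun y => (f y).re) x, pd k (fun y => (f y).imI) x,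
   pd k (fun y => (f y).imJ) x, pd k (fun y => (f y).imK) x⟩

/-- The Moisil–Theodoresco operator `Df = i₁∂₁f + i₂∂₂f + i₃∂₃f`. -/
def Dq (f : EuclideanSpace ℝ (Fin 3) → Quaternion ℂ) (x : EuclideanSpace ℝ (Fin 3)) :
    Quaternion ℂ :=
  vecQ ![1,0,0] * pdQ 0 f x + vecQ ![0,1,0] * pdQ 1 f x + vecQ ![0,0,1] * pdQ 2 f x

/-- Laplacian of a `ℂ`-valued function on Euclidean `ℝ³`. -/
def lap (h : EuclideanSpace ℝ (Fin 3) → ℂ) (x : EuclideanSpace ℝ (Fin 3)) : ℂ :=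
  ∑ k : Fin 3, pd k (fun y => pd k h y) x

/-- Partial derivatives of a radial function `y ↦ g ‖y‖` away from the origin. -/
theorem pd_comp_norm {g : ℝ → ℂ} {g' : ℂ} {x : EuclideanSpace ℝ (Fin 3)} (hx : x ≠ 0)
    (hg : HasDerivAt g g' ‖x‖) (k : Fin 3) :
    pd k (fun y => g ‖y‖) x = (x k : ℂ) / (‖x‖ : ℂ) * g' := by
  have hnorm : HasFDerivAt (fun y : EuclideanSpace ℝ (Fin 3) => ‖y‖)
      ((1 / (2 * ‖x‖)) • (2 • innerSL ℝ x)) x := by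
    have h := (hasStrictFDerivAt_norm_sq x).hasFDerivAt.sqrt (by simpa using hx)
    simpa only [Real.sqrt_sq (norm_nonneg _)] using h
  have h := hg.hasFDerivAt.comp x hnorm
  have hx' : (‖x‖ : ℂ) ≠ 0 := by simpa using hx
  rw [pd, show (fun y : EuclideanSpace ℝ (Fin 3) => g ‖y‖) = g ∘ fun y => ‖y‖ from rfl, h.fderiv]
  simp [EuclideanSpace.inner_single_right]
  field_simp

/-- The radial profile of the Helmholtz fundamental solution. -/
theorem hasDerivAt_helmholtz_profile (c : ℂ) {r : ℝ} (hr : r ≠ 0) :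
    HasDerivAt (fun t : ℝ => Complex.exp (Complex.I * c * (t : ℂ)) / (4 * (Real.pi : ℂ) * (t : ℂ)))
      ((-1 / (r : ℂ) + Complex.I * c) *
        (Complex.exp (Complex.I * c * (r : ℂ)) / (4 * (Real.pi : ℂ) * (r : ℂ)))) r := by
  have hr' : (r : ℂ) ≠ 0 := by exact_mod_cast hr
  have hpi : (Real.pi : ℂ) ≠ 0 := by exact_mod_cast Real.pi_ne_zero
  have hid : HasDerivAt (fun t : ℝ => (t : ℂ)) 1 r := Complex.ofRealCLM.hasDerivAt
  refine ((hid.const_mul (Complex.I * c)).cexp.div (hid.const_mul (4 * (Real.pi : ℂ)))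
    (by simp [hr', hpi])).congr_deriv ?_
  field_simp
  ring

/-- Multiplying a pure quaternion by a scalar acts componentwise. -/
theorem vecQ_mul_coe (v : Fin 3 → ℂ) (a : ℂ) :
    vecQ v * (a : Quaternion ℂ) = vecQ (fun k => v k * a) := by
  rw [Quaternion.mul_coe_eq_smul]
  ext <;> simp only [Quaternion.re_smul, Quaternion.imI_smul, Quaternion.imJ_smul,
    Quaternion.imK_smul] <;> simp [vecQ, mul_comm]

/-- On scalar functions the Moisil–Theodoresco operator is the gradient. -/
theorem Dq_coe (g : EuclideanSpace ℝ (Fin 3) → ℂ) (x : EuclideanSpace ℝ (Fin 3)) :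
    Dq (fun y => (g y : Quaternion ℂ)) x = vecQ (fun k => pd k g x) := by
  have hpd (k : Fin 3) : pdQ k (fun y => (g y : Quaternion ℂ)) x = (pd k g x : Quaternion ℂ) := by
    ext <;> simp [pdQ, pd]
  simp only [Dq, hpd, vecQ_mul_coe]
  ext <;> simp only [Quaternion.re_add, Quaternion.imI_add, Quaternion.imJ_add,
    Quaternion.imK_add] <;> simp [vecQ]

/-- For `ψ(x) = e^{ic|x|}/(4π|x|)` regarded as a scalar `ℍ(ℂ)`-valued function,
`Dψ(x) = (-x/|x|² + ic·x/|x|)·ψ(x)` for `x ≠ 0`, with `x` the pure quaternion `Σ xₖiₖ`. -/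
theorem D_of_helmholtz_fundamental (c : ℂ) (x : EuclideanSpace ℝ (Fin 3)) (hx : x ≠ 0) :
    Dq (fun y => ((Complex.exp (Complex.I * c * (‖y‖ : ℂ))
          / (4 * (Real.pi : ℂ) * (‖y‖ : ℂ)) : ℂ) : Quaternion ℂ)) x
      = vecQ (fun k => -(x k : ℂ) / (‖x‖ : ℂ) ^ 2 + Complex.I * c * (x k : ℂ) / (‖x‖ : ℂ))
          * ((Complex.exp (Complex.I * c * (‖x‖ : ℂ))
              / (4 * (Real.pi : ℂ) * (‖x‖ : ℂ)) : ℂ) : Quaternion ℂ) := by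
  have hx' : (‖x‖ : ℂ) ≠ 0 := by simpa using hx
  have hpd := pd_comp_norm hx (hasDerivAt_helmholtz_profile c (norm_ne_zero_iff.mpr hx))
  rw [Dq_coe, vecQ_mul_coe]
  congr 1
  funext k
  rw [hpd]
  field_simp
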